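/- Let D be a positive integer, let p ∈ (0,1) be a constant, and let ω : ℕ → ℝ be any function with ω(n) → ∞ as n → ∞. For each n, let H_n be a simple graph on n vertices with maximum degree at most D, with e_n edges and aut(H_n) automorphisms. Then the probability that a random graph G ∈ G(n,p) satisfies C_{H_n}(G) ≥ (n! · p^{e_n} / aut(H_n)) / ω(n) tends to 1 as n → ∞. -/

import Mathlib

open SimpleGraph

/-- The number of copies of `H` in `G` (both graphs on the same `n` vertices): the number of
(not necessarily induced) subgraphs of `G` isomorphic to `H`.  Since `H` has the full vertex
set, these are exactly the spanning subgraphs `G' ≤ G` with `G'` isomorphic to `H`. -/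
noncomputable def numCopies {n : ℕ} (H G : SimpleGraph (Fin n)) : ℕ :=
  {G' : SimpleGraph (Fin n) | G' ≤ G ∧ Nonempty (G' ≃g H)}.ncard

/-- The number of automorphisms of `H`. -/
noncomputable def numAut {n : ℕ} (H : SimpleGraph (Fin n)) : ℕ :=
  Nat.card (H ≃g H)

/-- The `G(n, p)` probability of a single graph `G` on `n` vertices: each of the
`N = n(n-1)/2` possible edges is present independently with probability `p`, so `G`
occurs with probability `p^{e(G)} (1-p)^{N - e(G)}`. -/
noncomputable def gnpWeight (n : ℕ) (p : ℝ) (G : SimpleGraph (Fin n)) : ℝ :=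
  p ^ G.edgeSet.ncard * (1 - p) ^ (n * (n - 1) / 2 - G.edgeSet.ncard)

theorem sum_powerset_superset {α : Type*} [DecidableEq α] {A E : Finset α} (hA : A ⊆ E)
    (a b : ℝ) :
    ∑ S ∈ E.powerset, (if A ⊆ S then a ^ S.card * b ^ (E.card - S.card) else 0) =
      a ^ A.card * (a + b) ^ (E.card - A.card) := by
  have hIcc : E.powerset.filter (fun S => A ⊆ S) = Finset.Icc A E := by
    ext S
    simp [Finset.mem_Icc, and_comm]
  rw [← Finset.sum_filter, hIcc, Finset.Icc_eq_image_powerset hA, Finset.sum_image]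
  · rw [← Finset.card_sdiff_of_subset hA, ← Finset.sum_pow_mul_eq_add_pow, Finset.mul_sum]
    refine Finset.sum_congr rfl fun T hT => ?_
    have hT' := Finset.mem_powerset.1 hT
    have hdisj : Disjoint A T := (Finset.disjoint_sdiff).mono_right hT'
    rw [Finset.card_union_of_disjoint hdisj, Finset.card_sdiff_of_subset hA, pow_add, Nat.sub_sub]
    ring
  · intro S hS T hT h
    have hS' : Disjoint A S := (Finset.disjoint_sdiff).mono_right (Finset.mem_powerset.1 hS)
    have hT' : Disjoint A T := (Finset.disjoint_sdiff).mono_right (Finset.mem_powerset.1 hT)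
    have h' : A ∪ S = A ∪ T := h
    rw [← Finset.union_sdiff_cancel_left hS', h', Finset.union_sdiff_cancel_left hT']

/-- The probability of the set `S` when each element of `E` is kept independently with
probability `p`. -/
noncomputable def bernoulliWeight {α : Type*} (E : Finset α) (p : ℝ) (S : Finset α) : ℝ :=
  p ^ S.card * (1 - p) ^ (E.card - S.card)

/-- The density of the Bernoulli measure of parameter `p'` with respect to that of
parameter `p`. -/
noncomputable def bernoulliRatio {α : Type*} (E : Finset α) (p p' : ℝ) (S : Finset α) : ℝ :=
  (p' / p) ^ S.card * ((1 - p') / (1 - p)) ^ (E.card - S.card)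

/-- The normalized number of members of the family `A` contained in `S`. -/
noncomputable def normalizedCount {α ι : Type*} [DecidableEq α] [Fintype ι] (A : ι → Finset α)
    (p : ℝ) (e : ℕ) (S : Finset α) : ℝ :=
  (∑ i, if A i ⊆ S then (1 : ℝ) else 0) / (Fintype.card ι * p ^ e)

section Bernoulli

variable {α ι : Type*} [Fintype ι] {E : Finset α} {A : ι → Finset α}
  {p p' : ℝ} {e : ℕ}

theorem bernoulliWeight_nonneg (hp0 : 0 < p) (hp1 : p < 1) (S : Finset α) :
    0 ≤ bernoulliWeight E p S :=
  mul_nonneg (pow_nonneg hp0.le _) (pow_nonneg (by linarith) _)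

theorem sum_bernoulliWeight : ∑ S ∈ E.powerset, bernoulliWeight E p S = 1 := by
  simp [bernoulliWeight, Finset.sum_pow_mul_eq_add_pow]

theorem bernoulliWeight_mul_ratio (hp0 : 0 < p) (hp1 : p < 1) (S : Finset α) :
    bernoulliWeight E p S * bernoulliRatio E p p' S = bernoulliWeight E p' S := by
  have h1 : (1 - p) ≠ 0 := by linarith
  rw [bernoulliWeight, bernoulliRatio, bernoulliWeight, mul_mul_mul_comm, ← mul_pow, ← mul_pow,
    mul_div_cancel₀ _ hp0.ne', mul_div_cancel₀ _ h1]

theorem sum_bernoulliWeight_superset [DecidableEq α] {B : Finset α} (hB : B ⊆ E) :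
    ∑ S ∈ E.powerset, bernoulliWeight E p S * (if B ⊆ S then 1 else 0) = p ^ B.card := by
  simpa [bernoulliWeight] using sum_powerset_superset hB p (1 - p)

theorem sum_bernoulliWeight_mul_ratio_sq (hp0 : 0 < p) (hp1 : p < 1) :
    ∑ S ∈ E.powerset, bernoulliWeight E p S * bernoulliRatio E p p' S ^ 2 =
      (p' ^ 2 / p + (1 - p') ^ 2 / (1 - p)) ^ E.card := by
  have h1 : (1 - p) ≠ 0 := by linarith
  rw [← Finset.sum_pow_mul_eq_add_pow]
  refine Finset.sum_congr rfl fun S _ => ?_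
  rw [pow_two, ← mul_assoc, bernoulliWeight_mul_ratio hp0 hp1, bernoulliWeight, bernoulliRatio,
    mul_mul_mul_comm, ← mul_pow, ← mul_pow]
  congr 2 <;> ring

theorem sum_bernoulliWeight_div_ratio :
    ∑ S ∈ E.powerset, bernoulliWeight E p S * (bernoulliRatio E p p' S)⁻¹ =
      (p ^ 2 / p' + (1 - p) ^ 2 / (1 - p')) ^ E.card := by
  rw [← Finset.sum_pow_mul_eq_add_pow]
  refine Finset.sum_congr rfl fun S _ => ?_
  rw [bernoulliWeight, bernoulliRatio, mul_inv, mul_mul_mul_comm, ← inv_pow, ← inv_pow, ← mul_pow,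
    ← mul_pow]
  congr 2 <;> rw [inv_div] <;> ring

theorem sum_bernoulliWeight_mul_count_mul_ratio [DecidableEq α] [Nonempty ι] (hp0 : 0 < p) (hp1 : p < 1)
    (hA : ∀ i, A i ⊆ E) (hcard : ∀ i, (A i).card = e) :
    ∑ S ∈ E.powerset, bernoulliWeight E p S *
      (normalizedCount A p e S * bernoulliRatio E p p' S) = (p' / p) ^ e := by
  have hι : (Fintype.card ι : ℝ) ≠ 0 := by simp
  have : ∀ S, bernoulliWeight E p S * (normalizedCount A p e S * bernoulliRatio E p p' S) =
      (∑ i, bernoulliWeight E p' S * (if A i ⊆ S then 1 else 0)) /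
        (Fintype.card ι * p ^ e) := by
    intro S
    rw [← Finset.mul_sum, ← bernoulliWeight_mul_ratio (p' := p') hp0 hp1, normalizedCount]
    ring
  simp_rw [this]
  rw [← Finset.sum_div, Finset.sum_comm]
  simp_rw [sum_bernoulliWeight_superset (hA _), hcard]
  rw [Finset.sum_const, nsmul_eq_mul, Finset.card_univ, mul_div_mul_left _ _ hι, div_pow]

theorem sum_bernoulliWeight_mul_count_sq [DecidableEq α] [Nonempty ι] (hp0 : 0 < p)
    (hA : ∀ i, A i ⊆ E) (hcard : ∀ i, (A i).card = e) :
    ∑ S ∈ E.powerset, bernoulliWeight E p S * normalizedCount A p e S ^ 2 =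
      (∑ i, ∑ j, (p⁻¹) ^ (A i ∩ A j).card) / (Fintype.card ι : ℝ) ^ 2 := by
  have hι : (Fintype.card ι : ℝ) ≠ 0 := by simp
  have : ∀ S, bernoulliWeight E p S * normalizedCount A p e S ^ 2 =
      (∑ i, ∑ j, bernoulliWeight E p S * (if A i ∪ A j ⊆ S then 1 else 0)) /
        (Fintype.card ι * p ^ e) ^ 2 := by
    intro S
    rw [normalizedCount, div_pow, ← mul_div_assoc, pow_two (∑ i, _), Finset.sum_mul_sum,
      Finset.mul_sum]
    simp_rw [Finset.mul_sum, Finset.union_subset_iff, ite_and, ite_mul, one_mul, zero_mul]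
  simp_rw [this]
  rw [← Finset.sum_div, Finset.sum_comm]
  simp_rw [Finset.sum_comm (s := E.powerset)]
  simp_rw [sum_bernoulliWeight_superset (Finset.union_subset (hA _) (hA _))]
  have hp : ∀ i j, p ^ (A i ∪ A j).card = (p ^ e) ^ 2 * (p⁻¹) ^ (A i ∩ A j).card := by
    intro i j
    have h := Finset.card_union_add_card_inter (A i) (A j)
    rw [hcard, hcard] at h
    rw [inv_pow, ← div_eq_mul_inv, eq_div_iff (pow_ne_zero _ hp0.ne'), ← pow_add, h]
    ring
  simp_rw [hp, ← Finset.mul_sum]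
  rw [mul_pow, mul_comm ((Fintype.card ι : ℝ) ^ 2), mul_div_mul_left]
  exact pow_ne_zero _ (pow_ne_zero _ hp0.ne')

theorem sum_bernoulliWeight_count_lt_le [DecidableEq α] [Nonempty ι] (hp0 : 0 < p) (hp1 : p < 1)
    (hp0' : 0 < p') (hp1' : p' < 1)
    (hA : ∀ i, A i ⊆ E) (hcard : ∀ i, (A i).card = e) {ε : ℝ} (hε : 0 < ε) :
    ∑ S ∈ E.powerset, bernoulliWeight E p S * (if normalizedCount A p e S < ε then 1 else 0) ≤
      2 * ε * (p ^ 2 / p' + (1 - p) ^ 2 / (1 - p')) ^ E.card +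
      ((∑ i, ∑ j, (p⁻¹) ^ (A i ∩ A j).card) / (Fintype.card ι : ℝ) ^ 2 - 2 * (p' / p) ^ e +
        (p' ^ 2 / p + (1 - p') ^ 2 / (1 - p)) ^ E.card) / ε ^ 2 := by
  rw [← sum_bernoulliWeight_mul_count_sq hp0 hA hcard,
    ← sum_bernoulliWeight_mul_count_mul_ratio hp0 hp1 hA hcard,
    ← sum_bernoulliWeight_mul_ratio_sq hp0 hp1, ← sum_bernoulliWeight_div_ratio,
    Finset.mul_sum, Finset.mul_sum, ← Finset.sum_sub_distrib, ← Finset.sum_add_distrib,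
    Finset.sum_div, ← Finset.sum_add_distrib]
  refine Finset.sum_le_sum fun S _ => ?_
  have hw := bernoulliWeight_nonneg (E := E) hp0 hp1 S
  have hR : 0 < bernoulliRatio E p p' S := by
    unfold bernoulliRatio
    have : 0 < 1 - p := by linarith
    have : 0 < 1 - p' := by linarith
    positivity
  set w := bernoulliWeight E p S
  set R := bernoulliRatio E p p' S
  set Y := normalizedCount A p e S
  have key : (if Y < ε then (1 : ℝ) else 0) ≤ 2 * ε * R⁻¹ + (Y - R) ^ 2 / ε ^ 2 := by
    split_ifs with h
    · rcases lt_or_ge R (2 * ε) with h2 | h2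
      · have : 1 ≤ 2 * ε * R⁻¹ := by
          rw [← div_eq_mul_inv, one_le_div hR]; exact h2.le
        have : 0 ≤ (Y - R) ^ 2 / ε ^ 2 := by positivity
        linarith
      · have : 1 ≤ (Y - R) ^ 2 / ε ^ 2 := by
          rw [one_le_div (by positivity)]
          nlinarith
        have : 0 ≤ 2 * ε * R⁻¹ := by positivity
        linarith
    · positivity
  calc w * (if Y < ε then (1 : ℝ) else 0) ≤ w * (2 * ε * R⁻¹ + (Y - R) ^ 2 / ε ^ 2) :=
        mul_le_mul_of_nonneg_left key hw
    _ = _ := by ring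

end Bernoulli

theorem card_perm_trans_eq {κ V : Type*} [Fintype κ] [Fintype V] [DecidableEq V] [DecidableEq κ]
    (x y : κ ↪ V) :
    (Fintype.card V).descFactorial (Fintype.card κ) *
      (Finset.univ.filter fun σ : Equiv.Perm V => x.trans σ.toEmbedding = y).card =
      (Fintype.card V).factorial := by
  have hconst : ∀ z : κ ↪ V,
      (Finset.univ.filter fun σ : Equiv.Perm V => x.trans σ.toEmbedding = z).card =
      (Finset.univ.filter fun σ : Equiv.Perm V => x.trans σ.toEmbedding = y).card := by
    intro z
    let τ : Equiv.Perm V := Equiv.extendSubtype (p := (· ∈ Set.range y)) (q := (· ∈ Set.range z))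
      ((Equiv.ofInjective y y.injective).symm.trans (Equiv.ofInjective z z.injective))
    have hτ : ∀ k, τ (y k) = z k := by
      intro k
      have := Equiv.extendSubtype_apply_of_mem
        (p := (· ∈ Set.range y)) (q := (· ∈ Set.range z))
        ((Equiv.ofInjective y y.injective).symm.trans (Equiv.ofInjective z z.injective))
        (y k) ⟨k, rfl⟩
      rw [show τ (y k) = _ from this]
      have h2 : (⟨y k, ⟨k, rfl⟩⟩ : Set.range y) = Equiv.ofInjective y y.injective k := rfl
      rw [h2]
      simp
    symm
    refine Finset.card_equiv (Equiv.mulLeft τ) fun σ => ?_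
    simp only [Finset.mem_filter, Finset.mem_univ, true_and, DFunLike.ext_iff]
    refine forall_congr' fun k => ?_
    simp only [Function.Embedding.trans_apply, Equiv.coe_toEmbedding, Equiv.coe_mulLeft,
      Equiv.Perm.mul_apply, ← hτ k, τ.injective.eq_iff]
  have := Finset.card_eq_sum_card_fiberwise (s := (Finset.univ : Finset (Equiv.Perm V)))
    (t := (Finset.univ : Finset (κ ↪ V))) (f := fun σ => x.trans σ.toEmbedding) (by simp)
  simp_rw [hconst] at this
  rw [Finset.sum_const, Finset.card_univ, Finset.card_univ, Fintype.card_perm,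
    Fintype.card_embedding_eq, smul_eq_mul] at this
  exact this.symm

theorem sum_perm_card_filter_trans_mem {κ V : Type*} [Fintype κ] [Fintype V] [DecidableEq V]
    [DecidableEq κ] (P Q : Finset (κ ↪ V)) :
    (Fintype.card V).descFactorial (Fintype.card κ) *
      ∑ σ : Equiv.Perm V, (P.filter fun x => x.trans σ.toEmbedding ∈ Q).card =
      P.card * Q.card * (Fintype.card V).factorial := by
  have h1 : ∀ σ : Equiv.Perm V, (P.filter fun x => x.trans σ.toEmbedding ∈ Q).card =
      ∑ x ∈ P, ∑ y ∈ Q, if x.trans σ.toEmbedding = y then 1 else 0 := by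
    intro σ
    rw [Finset.card_filter]
    exact Finset.sum_congr rfl fun x _ => by rw [Finset.sum_ite_eq]
  simp_rw [h1]
  rw [Finset.sum_comm]
  simp_rw [Finset.sum_comm (s := Finset.univ) (t := Q), ← Finset.card_filter, Finset.mul_sum,
    card_perm_trans_eq, Finset.sum_const, smul_eq_mul, mul_assoc]

section Matchings

variable {V : Type*} [Fintype V]

open scoped Classical in
/-- Ordered matchings of size `k` in `G`, each edge being given an orientation. -/
noncomputable def orderedMatchings (G : SimpleGraph V) (k : ℕ) : Finset (Fin k × Bool ↪ V) :=
  Finset.univ.filter fun x => ∀ i, G.Adj (x (i, false)) (x (i, true))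

open scoped Classical in
/-- Ordered paths with two edges in `G`, starting with the middle vertex. -/
noncomputable def orderedCherries (G : SimpleGraph V) : Finset (Fin 3 ↪ V) :=
  Finset.univ.filter fun x => G.Adj (x 0) (x 1) ∧ G.Adj (x 0) (x 2)

theorem mem_orderedMatchings {G : SimpleGraph V} {k : ℕ} {x : Fin k × Bool ↪ V} :
    x ∈ orderedMatchings G k ↔ ∀ i, G.Adj (x (i, false)) (x (i, true)) := by
  simp [orderedMatchings]

theorem mem_orderedCherries {G : SimpleGraph V} {x : Fin 3 ↪ V} :
    x ∈ orderedCherries G ↔ G.Adj (x 0) (x 1) ∧ G.Adj (x 0) (x 2) := by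
  simp [orderedCherries]

theorem card_orderedMatchings_le (G : SimpleGraph V) (k : ℕ) :
    (orderedMatchings G k).card ≤ (2 * G.edgeSet.ncard) ^ k := by
  classical
  have h : 2 * G.edgeSet.ncard = Fintype.card G.Dart := by
    rw [dart_card_eq_twice_card_edges, ← coe_edgeFinset, Set.ncard_coe_finset]
  rw [h, ← Fintype.card_coe]
  have := Fintype.card_le_of_injective
    (fun (x : orderedMatchings G k) (i : Fin k) =>
      (⟨(x.1 (i, false), x.1 (i, true)), mem_orderedMatchings.1 x.2 i⟩ : G.Dart)) (by
      intro x y hxy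
      ext ⟨i, b⟩
      have := congrFun hxy i
      simp only [Dart.mk.injEq, Prod.mk.injEq] at this
      cases b
      · exact this.1
      · exact this.2)
  simpa using this

theorem card_orderedCherries_le {G : SimpleGraph V} {D : ℕ}
    (hG : ∀ v, (G.neighborSet v).ncard ≤ D) :
    (orderedCherries G).card ≤ Fintype.card V * D ^ 2 := by
  classical
  have hdeg : ∀ v, G.degree v ≤ D := by
    intro v
    rw [← card_neighborSet_eq_degree, ← Nat.card_eq_fintype_card]
    exact hG v
  rw [← Fintype.card_coe]
  have := Fintype.card_le_of_injective
    (fun (x : orderedCherries G) =>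
      (⟨x.1 0, ⟨x.1 1, (mem_orderedCherries.1 x.2).1⟩, ⟨x.1 2, (mem_orderedCherries.1 x.2).2⟩⟩ :
        Σ v, G.neighborSet v × G.neighborSet v)) (by
      intro x y hxy
      have h0 : x.1 0 = y.1 0 := congrArg (fun z => z.1) hxy
      have h1 : x.1 1 = y.1 1 := congrArg (fun z => (z.2.1 : V)) hxy
      have h2 : x.1 2 = y.1 2 := congrArg (fun z => (z.2.2 : V)) hxy
      ext i
      fin_cases i
      · exact h0
      · exact h1
      · exact h2)
  refine this.trans ?_
  rw [Fintype.card_sigma]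
  calc _ ≤ ∑ v : V, D ^ 2 := Finset.sum_le_sum fun v _ => by
        rw [Fintype.card_prod, card_neighborSet_eq_degree, pow_two]
        exact Nat.mul_le_mul (hdeg v) (hdeg v)
    _ = _ := by simp

theorem le_card_orderedMatchings {G : SimpleGraph V} {m : ℕ} (h : (orderedMatchings G m).Nonempty)
    (k : ℕ) : m.descFactorial k * 2 ^ k ≤ (orderedMatchings G k).card := by
  classical
  obtain ⟨x, hx⟩ := h
  rw [mem_orderedMatchings] at hx
  rw [← Fintype.card_coe]
  have := Fintype.card_le_of_injective
    (fun (z : (Fin k ↪ Fin m) × (Fin k → Bool)) =>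
      (⟨⟨fun c => x (z.1 c.1, xor c.2 (z.2 c.1)), by
        rintro ⟨i, b⟩ ⟨j, c⟩ h
        have h' : (z.1 i, xor b (z.2 i)) = (z.1 j, xor c (z.2 j)) := x.injective h
        rw [Prod.mk.injEq, EmbeddingLike.apply_eq_iff_eq] at h'
        obtain ⟨rfl, h'⟩ := h'
        simpa using h'⟩, by
        rw [mem_orderedMatchings]
        intro i
        change G.Adj (x (z.1 i, xor false (z.2 i))) (x (z.1 i, xor true (z.2 i)))
        cases z.2 i
        · exact hx _
        · exact (hx _).symm⟩ : orderedMatchings G k)) (by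
      rintro ⟨g, b⟩ ⟨g', b'⟩ h
      have h' : ∀ i, x (g i, xor false (b i)) = x (g' i, xor false (b' i)) := fun i =>
        congrArg (fun z : orderedMatchings G k => z.1 (i, false)) h
      simp only [EmbeddingLike.apply_eq_iff_eq, Prod.mk.injEq, Bool.false_xor] at h'
      ext i
      · simp [(h' i).1]
      · simp [(h' i).2])
  simpa [Fintype.card_embedding_eq] using this

theorem exists_orderedMatchings_nonempty {G : SimpleGraph V} {D : ℕ}
    (hG : ∀ v, (G.neighborSet v).ncard ≤ D) :
    ∃ m ≤ Fintype.card V, (orderedMatchings G m).Nonempty ∧ G.edgeSet.ncard ≤ (2 * D - 1) * m := by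
  classical
  have hbound : ∀ m, (orderedMatchings G m).Nonempty → m ≤ Fintype.card V := by
    rintro m ⟨x, -⟩
    have := Fintype.card_le_of_injective x x.injective
    simp at this
    omega
  have h0 : (orderedMatchings G 0).Nonempty :=
    ⟨⟨fun i => i.1.elim0, fun i => i.1.elim0⟩, mem_orderedMatchings.2 fun i => i.elim0⟩
  obtain ⟨m, hm, hmax⟩ : ∃ m, (orderedMatchings G m).Nonempty ∧
      ¬ (orderedMatchings G (m + 1)).Nonempty := by
    by_contra! hcon
    have hall : ∀ m, (orderedMatchings G m).Nonempty := fun m => by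
      induction m with
      | zero => exact h0
      | succ m ih => exact hcon m ih
    have := hbound _ (hall (Fintype.card V + 1))
    omega
  refine ⟨m, hbound m hm, hm, ?_⟩
  obtain ⟨x, hx⟩ := hm
  rw [mem_orderedMatchings] at hx
  have hinc : ∀ v, (G.incidenceSet v).ncard ≤ D := fun v =>
    (Nat.card_congr (G.incidenceSetEquivNeighborSet v)).le.trans (hG v)
  have hpair : ∀ i, (G.incidenceSet (x (i, false)) ∪ G.incidenceSet (x (i, true))).ncard ≤
      2 * D - 1 := by
    intro i
    have h1 := Set.ncard_union_add_ncard_inter (G.incidenceSet (x (i, false)))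
      (G.incidenceSet (x (i, true)))
    have h2 : 0 < (G.incidenceSet (x (i, false)) ∩ G.incidenceSet (x (i, true))).ncard := by
      rw [Set.ncard_pos]
      exact ⟨s(x (i, false), x (i, true)), ⟨hx i, by simp⟩, ⟨hx i, by simp⟩⟩
    have h3 := hinc (x (i, false))
    have h4 := hinc (x (i, true))
    omega
  have hcover : G.edgeSet ⊆
      ⋃ i, (G.incidenceSet (x (i, false)) ∪ G.incidenceSet (x (i, true))) := by
    intro f
    induction f using Sym2.ind with
    | _ u v =>
      intro hf
      by_contra hnot
      have hne : ∀ c, x c ≠ u ∧ x c ≠ v := by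
        rintro ⟨i, b⟩
        constructor
        · rintro rfl
          refine hnot (Set.mem_iUnion.2 ⟨i, ?_⟩)
          cases b
          · exact Or.inl ⟨hf, by simp⟩
          · exact Or.inr ⟨hf, by simp⟩
        · rintro rfl
          refine hnot (Set.mem_iUnion.2 ⟨i, ?_⟩)
          cases b
          · exact Or.inl ⟨hf, by simp⟩
          · exact Or.inr ⟨hf, by simp⟩
      have huv : u ≠ v := G.ne_of_adj hf
      let y : Fin (m + 1) × Bool → V := fun c =>
        Fin.cases (motive := fun _ => V) (if c.2 then v else u) (fun j => x (j, c.2)) c.1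
      have hy0 : ∀ b, y (0, b) = if b then v else u := fun _ => rfl
      have hys : ∀ j b, y (j.succ, b) = x (j, b) := fun _ _ => rfl
      have hy : Function.Injective y := by
        rintro ⟨i, b⟩ ⟨j, c⟩ h
        induction i using Fin.cases with
        | zero =>
          induction j using Fin.cases with
          | zero =>
            rw [hy0, hy0] at h
            cases b <;> cases c <;> simp_all
          | succ j =>
            rw [hy0, hys] at h
            have := hne (j, c)
            cases b <;> simp_all
        | succ i =>
          induction j using Fin.cases with
          | zero =>
            rw [hy0, hys] at h
            have := hne (i, b)
            cases c <;> simp_all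
          | succ j =>
            rw [hys, hys] at h
            have := x.injective h
            simp_all
      refine hmax ⟨⟨y, hy⟩, mem_orderedMatchings.2 fun i => ?_⟩
      induction i using Fin.cases with
      | zero => exact hf
      | succ i => exact hx i
  calc G.edgeSet.ncard ≤ _ := Set.ncard_le_ncard hcover
    _ ≤ ∑ i, (G.incidenceSet (x (i, false)) ∪ G.incidenceSet (x (i, true))).ncard :=
        Set.ncard_iUnion_le_of_fintype _
    _ ≤ ∑ _i : Fin m, (2 * D - 1) := Finset.sum_le_sum fun i _ => hpair i
    _ = _ := by simp [mul_comm]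

/-- The generating function of the matchings of `G` by their size. -/
noncomputable def matchingSum (G : SimpleGraph V) (s : ℝ) : ℝ :=
  ∑ k ∈ Finset.range (Fintype.card V + 1),
    s ^ k * (orderedMatchings G k).card / (k.factorial * 2 ^ k)

theorem pow_edges_le_matchingSum {G : SimpleGraph V} {D : ℕ}
    (hG : ∀ v, (G.neighborSet v).ncard ≤ D) {a : ℝ} (ha : 1 ≤ a) :
    a ^ G.edgeSet.ncard ≤ matchingSum G (a ^ (2 * D - 1) - 1) := by
  obtain ⟨m, hmV, hm, hcard⟩ := exists_orderedMatchings_nonempty hG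
  set s := a ^ (2 * D - 1) - 1 with hs
  have hs0 : 0 ≤ s := sub_nonneg.2 (one_le_pow₀ ha)
  calc a ^ G.edgeSet.ncard ≤ a ^ ((2 * D - 1) * m) := pow_le_pow_right₀ ha hcard
    _ = (s + 1) ^ m := by rw [pow_mul, hs, sub_add_cancel]
    _ = ∑ k ∈ Finset.range (m + 1), s ^ k * m.choose k := by
        rw [add_pow]; simp
    _ ≤ ∑ k ∈ Finset.range (Fintype.card V + 1), s ^ k * m.choose k :=
        Finset.sum_le_sum_of_subset_of_nonneg (Finset.range_mono (by omega))
          fun _ _ _ => by positivity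
    _ ≤ _ := Finset.sum_le_sum fun k _ => by
        rw [mul_div_assoc]
        refine mul_le_mul_of_nonneg_left ?_ (by positivity)
        rw [le_div_iff₀ (by positivity)]
        have := le_card_orderedMatchings hm k
        rw [Nat.descFactorial_eq_factorial_mul_choose] at this
        calc (m.choose k : ℝ) * (k.factorial * 2 ^ k) =
            ((k.factorial * m.choose k * 2 ^ k : ℕ) : ℝ) := by push_cast; ring
          _ ≤ _ := by exact_mod_cast this

theorem matchingSum_nonneg (G : SimpleGraph V) {s : ℝ} (hs : 0 ≤ s) : 0 ≤ matchingSum G s :=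
  Finset.sum_nonneg fun _ _ => by positivity

theorem pow_edges_le {G : SimpleGraph V} {D : ℕ}
    (hG : ∀ v, (G.neighborSet v).ncard ≤ D) {a δ : ℝ} (ha : 1 ≤ a) (hδ : 0 < δ) :
    a ^ G.edgeSet.ncard ≤ matchingSum G (a - 1) +
      (δ * matchingSum G ((a ^ 2) ^ (2 * D - 1) - 1) + (orderedCherries G).card / δ) := by
  have h2 := pow_edges_le_matchingSum hG (one_le_pow₀ ha (n := 2))
  have hN2 := (pow_nonneg (sq_nonneg a) _).trans h2
  rcases (orderedCherries G).eq_empty_or_nonempty with h | h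
  · have hdeg : ∀ v, (G.neighborSet v).ncard ≤ 1 := by
      intro v
      rw [Set.ncard_le_one]
      intro u hu w hw
      by_contra huw
      have hvu := G.ne_of_adj hu
      have hvw := G.ne_of_adj hw
      have hinj : Function.Injective ![v, u, w] := by
        intro i j hij
        fin_cases i <;> fin_cases j <;> simp_all
      have : (⟨![v, u, w], hinj⟩ : Fin 3 ↪ V) ∈ orderedCherries G :=
        mem_orderedCherries.2 ⟨hu, hw⟩
      simp [h] at this
    have h1 := pow_edges_le_matchingSum hdeg ha
    simp only [mul_one, Nat.add_one_sub_one, pow_one] at h1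
    have : 0 ≤ ((orderedCherries G).card : ℝ) / δ := by positivity
    nlinarith
  · have hc : (1 : ℝ) ≤ (orderedCherries G).card := by exact_mod_cast h.card_pos
    have h1 := matchingSum_nonneg G (s := a - 1) (by linarith)
    set b := a ^ G.edgeSet.ncard with hb
    rw [← pow_mul, mul_comm 2, pow_mul, ← hb] at h2
    have h3 : b ≤ δ * b ^ 2 + 1 / δ := by
      have hsq : 0 ≤ (δ * b - 1) ^ 2 / δ := by positivity
      have hb0 : 0 ≤ b := by positivity
      have : (δ * b - 1) ^ 2 / δ = δ * b ^ 2 + 1 / δ - 2 * b := by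
        field_simp
        ring
      linarith
    have h4 : 1 / δ ≤ (orderedCherries G).card / δ := by gcongr
    have h5 := mul_le_mul_of_nonneg_left h2 hδ.le
    linarith

end Matchings

section Overlap

variable {V : Type*} [Fintype V]

theorem card_filter_trans_average {κ : Type*} [Fintype κ] [DecidableEq V] [DecidableEq κ]
    (P Q : Finset (κ ↪ V)) :
    (∑ σ : Equiv.Perm V, ((P.filter fun x => x.trans σ.toEmbedding ∈ Q).card : ℝ)) /
        (Fintype.card V).factorial =
      P.card * Q.card / (Fintype.card V).descFactorial (Fintype.card κ) := by
  have h := sum_perm_card_filter_trans_mem P Q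
  rcases lt_or_ge (Fintype.card V) (Fintype.card κ) with hlt | hle
  · have : IsEmpty (κ ↪ V) := Function.Embedding.isEmpty_of_card_lt hlt
    simp [Finset.eq_empty_of_isEmpty]
  · have hd : ((Fintype.card V).descFactorial (Fintype.card κ) : ℝ) ≠ 0 := by
      exact_mod_cast (Nat.descFactorial_pos.2 hle).ne'
    rw [div_eq_div_iff (by positivity) hd, mul_comm]
    exact_mod_cast h

theorem orderedMatchings_inf_comap [DecidableEq V] (H K : SimpleGraph V) (σ : Equiv.Perm V)
    (k : ℕ) :
    orderedMatchings (H ⊓ K.comap σ) k =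
      (orderedMatchings H k).filter fun x => x.trans σ.toEmbedding ∈ orderedMatchings K k := by
  ext x
  simp [mem_orderedMatchings, forall_and]

theorem orderedCherries_inf_comap [DecidableEq V] (H K : SimpleGraph V) (σ : Equiv.Perm V) :
    orderedCherries (H ⊓ K.comap σ) =
      (orderedCherries H).filter fun x => x.trans σ.toEmbedding ∈ orderedCherries K := by
  ext x
  simp only [mem_orderedCherries, Finset.mem_filter, inf_adj, comap_adj]
  exact and_and_and_comm

/-- An upper bound for the average of `matchingSum` over the overlaps of two graphs with `e`
edges on `n` vertices. -/
noncomputable def overlapSeries (n e : ℕ) (s : ℝ) : ℝ :=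
  ∑ k ∈ Finset.range (n + 1),
    (2 * (e : ℝ) ^ 2 * s) ^ k / k.factorial / n.descFactorial (2 * k)

theorem average_matchingSum_le [DecidableEq V] {H K : SimpleGraph V} {e : ℕ}
    (hH : H.edgeSet.ncard = e) (hK : K.edgeSet.ncard = e) {s : ℝ} (hs : 0 ≤ s) :
    (∑ σ : Equiv.Perm V, matchingSum (H ⊓ K.comap σ) s) / (Fintype.card V).factorial ≤
      overlapSeries (Fintype.card V) e s := by
  unfold matchingSum overlapSeries
  rw [Finset.sum_comm, Finset.sum_div]
  refine Finset.sum_le_sum fun k _ => ?_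
  have h := card_filter_trans_average (orderedMatchings H k) (orderedMatchings K k)
  simp_rw [← orderedMatchings_inf_comap] at h
  simp only [Fintype.card_prod, Fintype.card_fin, Fintype.card_bool, mul_comm k 2] at h
  have hH' : ((orderedMatchings H k).card : ℝ) ≤ (2 * e) ^ k := by
    exact_mod_cast hH ▸ card_orderedMatchings_le H k
  have hK' : ((orderedMatchings K k).card : ℝ) ≤ (2 * e) ^ k := by
    exact_mod_cast hK ▸ card_orderedMatchings_le K k
  calc _ = s ^ k / (k.factorial * 2 ^ k) * ((∑ σ : Equiv.Perm V,
        ((orderedMatchings (H ⊓ K.comap σ) k).card : ℝ)) / (Fintype.card V).factorial) := by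
        rw [← Finset.sum_div, ← Finset.mul_sum]; ring
    _ ≤ s ^ k / (k.factorial * 2 ^ k) *
        ((2 * e) ^ k * (2 * e) ^ k / (Fintype.card V).descFactorial (2 * k)) := by
        rw [h]; gcongr
    _ = _ := by
        have : (2 * (e : ℝ) ^ 2 * s) ^ k * 2 ^ k = s ^ k * ((2 * e) ^ k * (2 * e) ^ k) := by
          rw [← mul_pow, ← mul_pow, ← mul_pow]; ring
        have h2 : (2 * (e : ℝ) ^ 2 * s) ^ k = s ^ k * ((2 * e) ^ k * (2 * e) ^ k) / 2 ^ k := by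
          rw [← this, mul_div_cancel_right₀ _ (by positivity)]
        rw [h2]; ring

theorem average_pow_overlap_le [DecidableEq V] {H K : SimpleGraph V} {e D : ℕ}
    (hH : H.edgeSet.ncard = e) (hK : K.edgeSet.ncard = e)
    (hHD : ∀ v, (H.neighborSet v).ncard ≤ D) (hKD : ∀ v, (K.neighborSet v).ncard ≤ D)
    {a δ : ℝ} (ha : 1 ≤ a) (hδ : 0 < δ) :
    (∑ σ : Equiv.Perm V, a ^ (H ⊓ K.comap σ).edgeSet.ncard) / (Fintype.card V).factorial ≤
      overlapSeries (Fintype.card V) e (a - 1) +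
      (δ * overlapSeries (Fintype.card V) e ((a ^ 2) ^ (2 * D - 1) - 1) +
        (Fintype.card V * D ^ 2) ^ 2 / (Fintype.card V).descFactorial 3 / δ) := by
  have hdeg : ∀ σ : Equiv.Perm V, ∀ v, ((H ⊓ K.comap σ).neighborSet v).ncard ≤ D := fun σ v =>
    (Set.ncard_le_ncard (fun _ hu => hu.1) (Set.toFinite _)).trans (hHD v)
  have ha2 : 1 ≤ (a ^ 2) ^ (2 * D - 1) := one_le_pow₀ (one_le_pow₀ ha)
  have h1 := average_matchingSum_le hH hK (sub_nonneg.2 ha)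
  have h2 := average_matchingSum_le hH hK (sub_nonneg.2 ha2)
  have h3 := card_filter_trans_average (orderedCherries H) (orderedCherries K)
  simp_rw [← orderedCherries_inf_comap, Fintype.card_fin] at h3
  have hH' : ((orderedCherries H).card : ℝ) ≤ Fintype.card V * D ^ 2 := by
    exact_mod_cast card_orderedCherries_le hHD
  have hK' : ((orderedCherries K).card : ℝ) ≤ Fintype.card V * D ^ 2 := by
    exact_mod_cast card_orderedCherries_le hKD
  calc _ ≤ (∑ σ : Equiv.Perm V, (matchingSum (H ⊓ K.comap σ) (a - 1) +
        (δ * matchingSum (H ⊓ K.comap σ) ((a ^ 2) ^ (2 * D - 1) - 1) +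
          (orderedCherries (H ⊓ K.comap σ)).card / δ))) / (Fintype.card V).factorial := by
        gcongr with σ
        exact pow_edges_le (hdeg σ) ha hδ
    _ = (∑ σ : Equiv.Perm V, matchingSum (H ⊓ K.comap σ) (a - 1)) / (Fintype.card V).factorial +
        (δ * ((∑ σ : Equiv.Perm V, matchingSum (H ⊓ K.comap σ) ((a ^ 2) ^ (2 * D - 1) - 1)) /
          (Fintype.card V).factorial) +
        (∑ σ : Equiv.Perm V, ((orderedCherries (H ⊓ K.comap σ)).card : ℝ)) /
          (Fintype.card V).factorial / δ) := by
        rw [Finset.sum_add_distrib, Finset.sum_add_distrib, ← Finset.mul_sum, ← Finset.sum_div]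
        ring
    _ ≤ _ := by
        rw [h3, pow_two ((Fintype.card V : ℝ) * D ^ 2)]
        gcongr

end Overlap

section Asymptotics

open Filter Topology

/-- The ratio between `(n (n - 1)) ^ k` and the falling factorial with `2 * k` factors. -/
noncomputable def fallingRatio (n k : ℕ) : ℝ :=
  ((n : ℝ) * (n - 1)) ^ k / n.descFactorial (2 * k)

/-- An upper bound for the deviation of `overlapSeries` from an exponential. -/
noncomputable def overlapError (n : ℕ) (t : ℝ) : ℝ :=
  ∑' k : ℕ, t ^ k / k.factorial * |fallingRatio n k - 1|

theorem pow_le_exp_mul_descFactorial {n j : ℕ} (hj : j ≤ n) :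
    (n : ℝ) ^ j ≤ Real.exp j * n.descFactorial j := by
  have h1 : j.factorial * n ^ j ≤ n.descFactorial j * j ^ j := by
    have := Finset.prod_le_prod' (s := Finset.range j) (f := fun i => (j - i) * n)
      (g := fun i => (n - i) * j) fun i _ => by
        rw [Nat.sub_mul, Nat.sub_mul, mul_comm j n]
        exact Nat.sub_le_sub_left (Nat.mul_le_mul_left i hj) _
    simpa [← Nat.descFactorial_self, Nat.descFactorial_eq_prod_range, Finset.prod_mul_distrib]
      using this
  have h2 := Real.pow_div_factorial_le_exp (x := j) (by positivity) j
  rw [div_le_iff₀ (by positivity)] at h2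
  have h1' : (j.factorial : ℝ) * n ^ j ≤ n.descFactorial j * j ^ j := by exact_mod_cast h1
  have hf : (0 : ℝ) < j.factorial := by positivity
  refine le_of_mul_le_mul_left (h1'.trans ?_) hf
  calc (n.descFactorial j : ℝ) * j ^ j ≤ n.descFactorial j * (Real.exp j * j.factorial) := by
        gcongr
    _ = _ := by ring

theorem fallingRatio_nonneg (n k : ℕ) : 0 ≤ fallingRatio n k := by
  unfold fallingRatio
  rcases n with _ | n
  · simp
    positivity
  · have : (0 : ℝ) ≤ (n + 1 : ℕ) - 1 := by simp
    positivity

theorem fallingRatio_le (n k : ℕ) : fallingRatio n k ≤ Real.exp 2 ^ k := by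
  rcases lt_or_ge n (2 * k) with h | h
  · rw [fallingRatio, Nat.descFactorial_eq_zero_iff_lt.2 h]
    simp
    positivity
  · have hd : (0 : ℝ) < n.descFactorial (2 * k) := by
      exact_mod_cast Nat.descFactorial_pos.2 h
    rw [fallingRatio, div_le_iff₀ hd, ← Real.exp_nat_mul]
    have h1 := pow_le_exp_mul_descFactorial h
    rcases Nat.eq_zero_or_pos n with rfl | hn
    · obtain rfl : k = 0 := by omega
      simp
    have hn' : (1 : ℝ) ≤ n := by exact_mod_cast hn
    calc ((n : ℝ) * (n - 1)) ^ k ≤ (n * n) ^ k := by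
          have : (0 : ℝ) ≤ n - 1 := by linarith
          gcongr
          linarith
      _ = (n : ℝ) ^ (2 * k) := by rw [pow_mul, pow_two]
      _ ≤ _ := by
          convert h1 using 3
          push_cast; ring

theorem tendsto_fallingRatio (k : ℕ) : Tendsto (fun n => fallingRatio n k) atTop (𝓝 1) := by
  have h1 : Tendsto (fun n : ℕ => ((n : ℝ) ^ (2 * k)) / n.descFactorial (2 * k)) atTop (𝓝 1) :=
    (Asymptotics.isEquivalent_iff_tendsto_one ((eventually_ge_atTop (2 * k)).mono fun n hn => by
      exact_mod_cast (Nat.descFactorial_pos.2 hn).ne')).1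
      (isEquivalent_descFactorial (2 * k)).symm
  have h2 : Tendsto (fun n : ℕ => (1 - 1 / (n : ℝ)) ^ k) atTop (𝓝 1) := by
    have := (tendsto_one_div_atTop_nhds_zero_nat (𝕜 := ℝ)).const_sub 1
    simpa using this.pow k
  have h3 := h2.mul h1
  rw [mul_one] at h3
  refine h3.congr' ((eventually_ge_atTop 1).mono fun n hn => ?_)
  have hn' : (n : ℝ) ≠ 0 := by positivity
  unfold fallingRatio
  rw [← mul_div_assoc, pow_mul, ← mul_pow]
  congr 2
  field_simp

theorem abs_fallingRatio_sub_one_le (n k : ℕ) : |fallingRatio n k - 1| ≤ Real.exp 2 ^ k := by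
  have h0 := fallingRatio_nonneg n k
  have h1 := fallingRatio_le n k
  have h2 : 1 ≤ Real.exp 2 ^ k := one_le_pow₀ (Real.one_le_exp (by norm_num))
  rw [abs_le]
  constructor <;> linarith

theorem overlapError_term_le {t : ℝ} (ht : 0 ≤ t) (n k : ℕ) :
    t ^ k / k.factorial * |fallingRatio n k - 1| ≤ (t * Real.exp 2) ^ k / k.factorial := by
  rw [mul_pow, mul_div_right_comm]
  exact mul_le_mul_of_nonneg_left (abs_fallingRatio_sub_one_le n k) (by positivity)

theorem summable_overlapError {t : ℝ} (ht : 0 ≤ t) (n : ℕ) :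
    Summable fun k : ℕ => t ^ k / k.factorial * |fallingRatio n k - 1| :=
  Summable.of_nonneg_of_le (fun _ => by positivity) (overlapError_term_le ht n)
    (Real.summable_pow_div_factorial _)

theorem tendsto_overlapError {t : ℝ} (ht : 0 ≤ t) :
    Tendsto (fun n => overlapError n t) atTop (𝓝 0) := by
  have := tendsto_tsum_of_dominated_convergence (𝓕 := atTop)
    (f := fun n k : ℕ => t ^ k / k.factorial * |fallingRatio n k - 1|) (g := fun _ => (0 : ℝ))
    (Real.summable_pow_div_factorial (t * Real.exp 2)) (fun k => by
      have := (((tendsto_fallingRatio k).sub_const 1).abs).const_mul (t ^ k / k.factorial)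
      simpa using this) (Eventually.of_forall fun n k => by
        rw [Real.norm_of_nonneg (by positivity)]
        exact overlapError_term_le ht n k)
  simpa [overlapError] using this

theorem overlapSeries_le {n e : ℕ} {l t s : ℝ} (hn : 2 ≤ n) (hs : 0 ≤ s)
    (hl : 2 * (e : ℝ) ^ 2 = l * (n * (n - 1))) (hlt : l ≤ t) :
    overlapSeries n e s ≤ Real.exp (l * s) + overlapError n (t * s) := by
  have hn' : (2 : ℝ) ≤ n := by exact_mod_cast hn
  have hpos : 0 < (n : ℝ) * (n - 1) := mul_pos (by linarith) (by linarith)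
  have hl0 : 0 ≤ l := by
    by_contra! h
    nlinarith [sq_nonneg (e : ℝ), mul_neg_of_neg_of_pos h hpos]
  have ht0 : 0 ≤ t := hl0.trans hlt
  calc overlapSeries n e s = ∑ k ∈ Finset.range (n + 1),
        (l * s) ^ k / k.factorial * fallingRatio n k := by
        refine Finset.sum_congr rfl fun k _ => ?_
        rw [hl, fallingRatio, mul_right_comm l, mul_pow (l * s)]
        ring
    _ ≤ ∑ k ∈ Finset.range (n + 1), ((l * s) ^ k / k.factorial +
          (t * s) ^ k / k.factorial * |fallingRatio n k - 1|) := by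
        refine Finset.sum_le_sum fun k _ => ?_
        have h1 : (l * s) ^ k / k.factorial * |fallingRatio n k - 1| ≤
            (t * s) ^ k / k.factorial * |fallingRatio n k - 1| := by gcongr
        have h2 : (l * s) ^ k / k.factorial * (fallingRatio n k - 1) ≤
            (l * s) ^ k / k.factorial * |fallingRatio n k - 1| :=
          mul_le_mul_of_nonneg_left (le_abs_self _) (by positivity)
        linarith
    _ ≤ _ := by
        rw [Finset.sum_add_distrib]
        exact add_le_add (Real.sum_le_exp_of_nonneg (by positivity) _)
          ((summable_overlapError (by positivity) n).sum_le_tsum _ fun _ _ => by positivity)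

end Asymptotics

section Copies

variable {V : Type*} [Fintype V]

/-- The edges of `G` as a finset, independently of any decidability instance. -/
noncomputable def finiteEdges (G : SimpleGraph V) : Finset (Sym2 V) :=
  (Set.toFinite G.edgeSet).toFinset

theorem card_finiteEdges (G : SimpleGraph V) : (finiteEdges G).card = G.edgeSet.ncard :=
  (Set.ncard_eq_toFinset_card G.edgeSet).symm

theorem finiteEdges_subset {G G' : SimpleGraph V} : finiteEdges G ⊆ finiteEdges G' ↔ G ≤ G' := by
  rw [finiteEdges, finiteEdges, Set.Finite.toFinset_subset_toFinset, edgeSet_subset_edgeSet]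

theorem finiteEdges_inter [DecidableEq V] (G G' : SimpleGraph V) :
    finiteEdges G ∩ finiteEdges G' = finiteEdges (G ⊓ G') := by
  ext f
  simp [finiteEdges]

theorem card_finiteEdges_top :
    (finiteEdges (⊤ : SimpleGraph V)).card = Fintype.card V * (Fintype.card V - 1) / 2 := by
  classical
  rw [← Nat.choose_two_right, ← card_edgeFinset_top_eq_card_choose_two]
  congr 1
  ext f
  simp [finiteEdges]

theorem sum_finiteEdges [Fintype (SimpleGraph V)] (f : Finset (Sym2 V) → ℝ) :
    ∑ G : SimpleGraph V, f (finiteEdges G) = ∑ S ∈ (finiteEdges (⊤ : SimpleGraph V)).powerset, f S := by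
  refine Finset.sum_bij (fun G _ => finiteEdges G)
    (fun G _ => Finset.mem_powerset.2 (finiteEdges_subset.2 le_top))
    (fun G _ G' _ h => le_antisymm (finiteEdges_subset.1 h.le) (finiteEdges_subset.1 h.ge))
    (fun S hS => ⟨fromEdgeSet S, Finset.mem_univ _, ?_⟩) (fun _ _ => rfl)
  ext f
  have : f ∈ S → ¬ f.IsDiag := fun hf => by
    simpa [finiteEdges] using Finset.mem_powerset.1 hS hf
  simpa [finiteEdges] using this

theorem two_mul_card_edges_le {G : SimpleGraph V} {D : ℕ}
    (hG : ∀ v, (G.neighborSet v).ncard ≤ D) : 2 * G.edgeSet.ncard ≤ D * Fintype.card V := by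
  classical
  rw [← coe_edgeFinset, Set.ncard_coe_finset, ← sum_degrees_eq_twice_card_edges]
  calc _ ≤ ∑ _v : V, D := Finset.sum_le_sum fun v _ => by
        rw [← card_neighborSet_eq_degree, ← Nat.card_eq_fintype_card]
        exact hG v
    _ = _ := by simp [mul_comm]

theorem ncard_edgeSet_comap {V : Type*} (G : SimpleGraph V) (σ : Equiv.Perm V) :
    (G.comap σ).edgeSet.ncard = G.edgeSet.ncard :=
  Nat.card_congr (Iso.comap σ G).mapEdgeSet

theorem ncard_neighborSet_comap {V : Type*} (G : SimpleGraph V) (σ : Equiv.Perm V) (v : V) :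
    ((G.comap σ).neighborSet v).ncard = (G.neighborSet (σ v)).ncard :=
  Nat.card_congr ((Iso.comap σ G).mapNeighborSet v)

/-- Isomorphisms onto `H` are the permutations pulling `H` back to the given graph. -/
def isoEquivComapEq (G H : SimpleGraph V) : (G ≃g H) ≃ {σ : Equiv.Perm V // H.comap σ = G} where
  toFun f := ⟨f.toEquiv, by ext a b; exact f.map_rel_iff'⟩
  invFun σ := ⟨σ.1, by rintro a b; obtain ⟨σ, rfl⟩ := σ; rfl⟩
  left_inv _ := rfl
  right_inv _ := rfl

theorem numAut_pos {n : ℕ} (H : SimpleGraph (Fin n)) : 0 < numAut H := by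
  have : Finite (H ≃g H) := Finite.of_equiv _ (isoEquivComapEq H H).symm
  have : Nonempty (H ≃g H) := ⟨Iso.refl⟩
  exact Nat.card_pos

open scoped Classical in
theorem numCopies_mul_numAut {n : ℕ} (H G : SimpleGraph (Fin n)) :
    numCopies H G * numAut H =
      (Finset.univ.filter fun σ : Equiv.Perm (Fin n) => H.comap σ ≤ G).card := by
  set C : Finset (SimpleGraph (Fin n)) :=
    Finset.univ.filter fun G' => G' ≤ G ∧ Nonempty (G' ≃g H) with hC
  have hcopies : numCopies H G = C.card := by
    rw [numCopies, ← Set.ncard_coe_finset]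
    simp [hC]
  have hmaps : ∀ σ ∈ Finset.univ.filter fun σ : Equiv.Perm (Fin n) => H.comap σ ≤ G,
      H.comap σ ∈ C := by
    intro σ hσ
    exact Finset.mem_filter.2
      ⟨Finset.mem_univ _, (Finset.mem_filter.1 hσ).2, ⟨Iso.comap σ H⟩⟩
  rw [Finset.card_eq_sum_card_fiberwise hmaps, hcopies, ← smul_eq_mul, ← Finset.sum_const]
  refine Finset.sum_congr rfl fun G' hG' => ?_
  obtain ⟨hle, ⟨f⟩⟩ := (Finset.mem_filter.1 hG').2
  have e : (H ≃g H) ≃ (G' ≃g H) :=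
    ⟨fun g => f.trans g, fun g => f.symm.trans g, fun g => by ext; simp, fun g => by ext; simp⟩
  rw [numAut, Nat.card_congr (e.trans (isoEquivComapEq G' H)), Nat.card_eq_fintype_card,
    Fintype.card_subtype, Finset.filter_filter]
  congr 1
  ext σ
  simp only [Finset.mem_filter, Finset.mem_univ, true_and]
  exact ⟨fun h => ⟨h ▸ hle, h⟩, fun h => h.2⟩

end Copies

section Estimates

open Filter Topology

/-- A vanishing bound for the second moment of the difference between the normalized number of
copies of a graph of maximum degree `D` and the density of the tilted Bernoulli measure. -/
noncomputable def secondMomentError (p : ℝ) (D n : ℕ) : ℝ :=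
  overlapError n (D ^ 2 * (p⁻¹ - 1)) +
    (1 / √n * (Real.exp (D ^ 2 * (((p⁻¹) ^ 2) ^ (2 * D - 1) - 1)) +
      overlapError n (D ^ 2 * (((p⁻¹) ^ 2) ^ (2 * D - 1) - 1))) +
      D ^ 4 * Real.exp 3 * (1 / √n)) +
    2 * (Real.exp (D ^ 2 * (p⁻¹ - 1)) * (D ^ 2 * (p⁻¹ - 1)) * (2 * D * (p⁻¹ - 1) * (1 / n)))

theorem tendsto_secondMomentError {p : ℝ} (hp0 : 0 < p) (hp1 : p < 1) (D : ℕ) :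
    Tendsto (secondMomentError p D) atTop (𝓝 0) := by
  have ha : 1 ≤ p⁻¹ := (one_le_inv₀ hp0).2 hp1.le
  have h1 := tendsto_overlapError (t := D ^ 2 * (p⁻¹ - 1))
    (mul_nonneg (by positivity) (sub_nonneg.2 ha))
  have h2 := tendsto_overlapError (t := D ^ 2 * (((p⁻¹) ^ 2) ^ (2 * D - 1) - 1))
    (mul_nonneg (by positivity) (sub_nonneg.2 (one_le_pow₀ (one_le_pow₀ ha))))
  have h3 : Tendsto (fun n : ℕ => 1 / √(n : ℝ)) atTop (𝓝 0) :=
    tendsto_const_nhds.div_atTop (Real.tendsto_sqrt_atTop.comp tendsto_natCast_atTop_atTop)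
  have h4 := tendsto_one_div_atTop_nhds_zero_nat (𝕜 := ℝ)
  have := (h1.add ((h3.mul (h2.const_add (Real.exp (D ^ 2 * (((p⁻¹) ^ 2) ^ (2 * D - 1) - 1))))).add
    (h3.const_mul (D ^ 4 * Real.exp 3)))).add
    (((h4.const_mul (2 * D * (p⁻¹ - 1))).const_mul
      (Real.exp (D ^ 2 * (p⁻¹ - 1)) * (D ^ 2 * (p⁻¹ - 1)))).const_mul 2)
  simp only [add_zero, mul_zero, zero_mul] at this
  exact this

theorem exp_sub_le_one_add_pow {x : ℝ} (hx : 0 ≤ x) (e : ℕ) :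
    Real.exp (e * x) - Real.exp (e * x) * (e * x) * x ≤ (1 + x) ^ e := by
  have hx1 : 0 < 1 + x := by linarith
  have h1 : Real.exp (e * (1 - (1 + x)⁻¹)) ≤ (1 + x) ^ e := by
    rw [Real.exp_nat_mul]
    refine pow_le_pow_left₀ (Real.exp_nonneg _) ?_ _
    rw [← Real.le_log_iff_exp_le hx1]
    exact Real.one_sub_inv_le_log_of_pos hx1
  refine le_trans ?_ h1
  have h2 : x - x * x ≤ 1 - (1 + x)⁻¹ := by
    have : 1 - (1 + x)⁻¹ - (x - x * x) = x ^ 3 / (1 + x) := by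
      field_simp
      ring
    have : 0 ≤ x ^ 3 / (1 + x) := by positivity
    linarith
  have h3 : (e : ℝ) * (x - x * x) ≤ e * (1 - (1 + x)⁻¹) := by gcongr
  have h4 := Real.add_one_le_exp (-(e * x * x))
  calc Real.exp (e * x) - Real.exp (e * x) * (e * x) * x
      = Real.exp (e * x) * (-(e * x * x) + 1) := by ring
    _ ≤ Real.exp (e * x) * Real.exp (-(e * x * x)) := by gcongr
    _ = Real.exp (e * (x - x * x)) := by rw [← Real.exp_add]; ring_nf
    _ ≤ _ := Real.exp_le_exp.2 h3

theorem one_add_pow_le_exp {x : ℝ} (hx : 0 ≤ x) (N : ℕ) : (1 + x) ^ N ≤ Real.exp (N * x) := by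
  rw [Real.exp_nat_mul]
  exact pow_le_pow_left₀ (by linarith) (by linarith [Real.add_one_le_exp x]) _

theorem bernoulliWeight_count_lt_le {n D : ℕ} (hn : 3 ≤ n) (hnD : 4 * D ≤ n) {p : ℝ} (hp0 : 0 < p)
    (hp1 : p < 1) {H : SimpleGraph (Fin n)} (hH : ∀ v, (H.neighborSet v).ncard ≤ D)
    {ε : ℝ} (hε : 0 < ε) :
    ∑ S ∈ (finiteEdges (⊤ : SimpleGraph (Fin n))).powerset,
      bernoulliWeight (finiteEdges (⊤ : SimpleGraph (Fin n))) p S *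
      (if normalizedCount (fun σ : Equiv.Perm (Fin n) => finiteEdges (H.comap σ)) p
        H.edgeSet.ncard S < ε then 1 else 0) ≤
      2 * ε * Real.exp (2 * D ^ 2 / p) + secondMomentError p D n / ε ^ 2 := by
  set e := H.edgeSet.ncard with he
  set E := finiteEdges (⊤ : SimpleGraph (Fin n)) with hE
  have hn' : (3 : ℝ) ≤ n := by exact_mod_cast hn
  have hnD' : 4 * (D : ℝ) ≤ n := by exact_mod_cast hnD
  have hn1 : (n : ℝ) - 1 ≠ 0 := by linarith
  have hpos : 0 < (n : ℝ) * (n - 1) := mul_pos (by linarith) (by linarith)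
  have hN : (E.card : ℝ) = n * (n - 1) / 2 := by
    rw [hE, card_finiteEdges_top, Fintype.card_fin, ← Nat.choose_two_right, Nat.cast_choose_two]
  have heD : 2 * (e : ℝ) ≤ D * n := by
    have := two_mul_card_edges_le hH
    rw [Fintype.card_fin] at this
    exact_mod_cast this
  set q : ℝ := 2 * e / (n * (n - 1)) with hq
  have hq0 : 0 ≤ q := by positivity
  have hNq : (E.card : ℝ) * q = e := by rw [hN, hq]; field_simp
  have hqn : q ≤ 2 * D * (1 / n) := by
    rw [hq, div_le_iff₀ hpos]
    calc 2 * (e : ℝ) ≤ D * n := heD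
      _ ≤ D * (2 * (n - 1)) := by gcongr; linarith
      _ = _ := by field_simp
  have hq2 : q ≤ 1 / 2 := by
    refine hqn.trans ?_
    rw [mul_one_div, div_le_iff₀ (by linarith)]
    linarith
  set l : ℝ := e * q with hl
  have hl0 : 0 ≤ l := by positivity
  have hle : 2 * (e : ℝ) ^ 2 = l * (n * (n - 1)) := by rw [hl, hq]; field_simp
  have hlD : l ≤ D ^ 2 := by
    calc l ≤ (D * n / 2) * (2 * D * (1 / n)) := by
          rw [hl]
          gcongr
          linarith
      _ = D ^ 2 := by field_simp
  set r : ℝ := p⁻¹ - 1 with hr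
  have hp1' : 0 < 1 - p := by linarith
  have ha : 1 ≤ p⁻¹ := (one_le_inv₀ hp0).2 hp1.le
  have hr0 : 0 ≤ r := sub_nonneg.2 ha
  set p' : ℝ := p + (1 - p) * q with hp'
  have hpp' : p ≤ p' := by
    have := mul_nonneg hp1'.le hq0
    linarith
  have hp'1 : 1 - p' = (1 - p) * (1 - q) := by rw [hp']; ring
  have hp'lt : p' < 1 := by
    have : 0 < (1 - p) * (1 - q) := mul_pos hp1' (by linarith)
    linarith
  have hcard : ∀ σ : Equiv.Perm (Fin n), (finiteEdges (H.comap σ)).card = e := fun σ => by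
    rw [card_finiteEdges, ncard_edgeSet_comap]
  have hinv : (p ^ 2 / p' + (1 - p) ^ 2 / (1 - p')) ^ E.card ≤ Real.exp (2 * D ^ 2 / p) := by
    have hq1 : 0 < 1 - q := by linarith
    have hp'0 : 0 < p' := hp0.trans_le hpp'
    have h1 : p ^ 2 / p' + (1 - p) ^ 2 / (1 - p') = 1 + (1 - p) * q ^ 2 / (p' * (1 - q)) := by
      rw [hp'1]
      field_simp
      rw [hp']
      ring
    have h2 : (1 - p) * q ^ 2 / (p' * (1 - q)) ≤ 2 * q ^ 2 / p := by
      rw [div_le_div_iff₀ (by positivity) hp0]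
      have h3 : p * (1 / 2) ≤ p' * (1 - q) := by
        gcongr
        linarith
      have h4 : (1 - p) * q ^ 2 ≤ 1 * q ^ 2 := by gcongr; linarith
      nlinarith [sq_nonneg q]
    calc _ ≤ (1 + 2 * q ^ 2 / p) ^ E.card := by
          rw [h1]
          gcongr
      _ ≤ Real.exp (E.card * (2 * q ^ 2 / p)) := one_add_pow_le_exp (by positivity) _
      _ ≤ _ := by
          rw [Real.exp_le_exp]
          calc (E.card : ℝ) * (2 * q ^ 2 / p) = 2 * l / p := by rw [hl, ← hNq]; ring
            _ ≤ _ := by gcongr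
  have hratio : p' / p = 1 + q * r := by rw [hp', hr]; field_simp
  have hsq : (p' ^ 2 / p + (1 - p') ^ 2 / (1 - p)) ^ E.card ≤ Real.exp (l * r) := by
    have h1 : p' ^ 2 / p + (1 - p') ^ 2 / (1 - p) = 1 + q ^ 2 * r := by
      rw [hp'1, hp', hr]
      field_simp
      ring
    rw [h1]
    refine (one_add_pow_le_exp (by positivity) _).trans_eq ?_
    rw [hl, ← hNq]
    ring_nf
  have hcross : Real.exp (l * r) - Real.exp (D ^ 2 * r) * (D ^ 2 * r) * (2 * D * r * (1 / n)) ≤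
      (p' / p) ^ e := by
    rw [hratio]
    refine le_trans ?_ (exp_sub_le_one_add_pow (by positivity) e)
    have h1 : (e : ℝ) * (q * r) = l * r := by rw [hl]; ring
    rw [h1]
    have h2 : q * r ≤ 2 * D * r * (1 / n) := by
      calc q * r ≤ (2 * D * (1 / n)) * r := by gcongr
        _ = _ := by ring
    have : Real.exp (l * r) * (l * r) * (q * r) ≤
        Real.exp (D ^ 2 * r) * (D ^ 2 * r) * (2 * D * r * (1 / n)) := by gcongr
    linarith
  set s : ℝ := ((p⁻¹) ^ 2) ^ (2 * D - 1) - 1 with hs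
  have hs0 : 0 ≤ s := sub_nonneg.2 (one_le_pow₀ (one_le_pow₀ ha))
  have hδ : 0 < 1 / √(n : ℝ) := by positivity
  set M : ℝ := Real.exp (l * r) + overlapError n (D ^ 2 * r) +
    (1 / √n * (Real.exp (D ^ 2 * s) + overlapError n (D ^ 2 * s)) +
      D ^ 4 * Real.exp 3 * (1 / √n)) with hM
  have hoverlap : ∀ τ : Equiv.Perm (Fin n), (∑ σ : Equiv.Perm (Fin n),
      (p⁻¹) ^ (finiteEdges (H.comap τ) ∩ finiteEdges (H.comap σ)).card) ≤ n.factorial * M := by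
    intro τ
    simp_rw [finiteEdges_inter, card_finiteEdges]
    have h := average_pow_overlap_le (ncard_edgeSet_comap H τ) (K := H) rfl
      (fun v => (ncard_neighborSet_comap H τ v).trans_le (hH _)) hH ha hδ
    rw [Fintype.card_fin, div_le_iff₀ (by positivity), mul_comm _ (n.factorial : ℝ)] at h
    refine h.trans (mul_le_mul_of_nonneg_left ?_ (by positivity))
    have h1 := overlapSeries_le (by omega) hr0 hle hlD
    have h2 := overlapSeries_le (by omega) hs0 hle hlD
    have h3 : Real.exp (l * s) ≤ Real.exp (D ^ 2 * s) := by
      rw [Real.exp_le_exp]; gcongr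
    have h4 : ((n : ℝ) * D ^ 2) ^ 2 / n.descFactorial 3 / (1 / √n) ≤
        D ^ 4 * Real.exp 3 * (1 / √n) := by
      have hd : (0 : ℝ) < n.descFactorial 3 := by
        exact_mod_cast Nat.descFactorial_pos.2 hn
      have h5 := pow_le_exp_mul_descFactorial hn
      push_cast at h5
      have hsn : √(n : ℝ) * √n = n := Real.mul_self_sqrt (by positivity)
      have hsn0 : 0 < √(n : ℝ) := by positivity
      rw [div_div, div_le_iff₀ (by positivity)]
      calc ((n : ℝ) * D ^ 2) ^ 2 = D ^ 4 * (n : ℝ) ^ 3 / n := by field_simp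
        _ ≤ D ^ 4 * (Real.exp 3 * n.descFactorial 3) / n := by gcongr
        _ = D ^ 4 * (Real.exp 3 * n.descFactorial 3) / (√n * √n) := by rw [hsn]
        _ = _ := by field_simp
    have h6 := mul_le_mul_of_nonneg_left (h2.trans (add_le_add_left h3 _)) hδ.le
    linarith
  have hsecond : (∑ τ : Equiv.Perm (Fin n), ∑ σ : Equiv.Perm (Fin n),
      (p⁻¹) ^ (finiteEdges (H.comap τ) ∩ finiteEdges (H.comap σ)).card) /
        (Fintype.card (Equiv.Perm (Fin n)) : ℝ) ^ 2 ≤ M := by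
    rw [Fintype.card_perm, Fintype.card_fin, div_le_iff₀ (by positivity)]
    calc _ ≤ ∑ _τ : Equiv.Perm (Fin n), n.factorial * M := Finset.sum_le_sum fun τ _ => hoverlap τ
      _ = _ := by
        rw [Finset.sum_const, Finset.card_univ, Fintype.card_perm, Fintype.card_fin, nsmul_eq_mul]
        ring
  refine (sum_bernoulliWeight_count_lt_le hp0 hp1 (hp0.trans_le hpp') hp'lt
    (fun σ => finiteEdges_subset.2 le_top) hcard hε).trans ?_
  gcongr
  rw [secondMomentError, ← hr, ← hs]
  linarith

theorem bernoulliWeight_finiteEdges {n : ℕ} (p : ℝ) (G : SimpleGraph (Fin n)) :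
    bernoulliWeight (finiteEdges (⊤ : SimpleGraph (Fin n))) p (finiteEdges G) =
      gnpWeight n p G := by
  rw [bernoulliWeight, gnpWeight, card_finiteEdges, card_finiteEdges_top, Fintype.card_fin]

theorem gnpWeight_nonneg {n : ℕ} {p : ℝ} (hp0 : 0 < p) (hp1 : p < 1) (G : SimpleGraph (Fin n)) :
    0 ≤ gnpWeight n p G :=
  bernoulliWeight_finiteEdges p G ▸ bernoulliWeight_nonneg hp0 hp1 _

theorem sum_indicator_gnpWeight_ge {n D : ℕ} (hn : 3 ≤ n) (hnD : 4 * D ≤ n) {p : ℝ} (hp0 : 0 < p)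
    (hp1 : p < 1) {H : SimpleGraph (Fin n)} (hH : ∀ v, (H.neighborSet v).ncard ≤ D)
    {ε w : ℝ} (hε : 0 < ε) (hw : ε⁻¹ ≤ w) :
    1 - (2 * ε * Real.exp (2 * D ^ 2 / p) + secondMomentError p D n / ε ^ 2) ≤
      ∑ G : SimpleGraph (Fin n),
        Set.indicator
          {G' : SimpleGraph (Fin n) |
            (n.factorial : ℝ) * p ^ H.edgeSet.ncard / (numAut H) / w ≤ (numCopies H G' : ℝ)}
          (gnpWeight n p) G := by
  classical
  rw [sub_le_comm]
  refine le_trans ?_ (bernoulliWeight_count_lt_le hn hnD hp0 hp1 hH hε)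
  conv_lhs => rw [← sum_bernoulliWeight (E := finiteEdges (⊤ : SimpleGraph (Fin n))) (p := p)]
  rw [← sum_finiteEdges, ← sum_finiteEdges, ← Finset.sum_sub_distrib]
  refine Finset.sum_le_sum fun G _ => ?_
  have hcount : normalizedCount (fun σ : Equiv.Perm (Fin n) => finiteEdges (H.comap σ)) p
      H.edgeSet.ncard (finiteEdges G) =
      (numCopies H G * numAut H : ℕ) / (n.factorial * p ^ H.edgeSet.ncard) := by
    rw [numCopies_mul_numAut, normalizedCount, Fintype.card_perm, Fintype.card_fin]
    simp_rw [finiteEdges_subset]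
    rw [Finset.sum_boole]
  rw [bernoulliWeight_finiteEdges, hcount]
  split_ifs with h
  · rw [mul_one, sub_le_self_iff]
    exact Set.indicator_nonneg (fun G' _ => gnpWeight_nonneg hp0 hp1 G') G
  · rw [mul_zero, Set.indicator_of_mem, sub_self]
    have hX : (0 : ℝ) < numAut H := by exact_mod_cast numAut_pos H
    have hw0 : 0 < w := (inv_pos.2 hε).trans_le hw
    have hwε : 1 ≤ ε * w := by
      rwa [inv_le_iff_one_le_mul₀ hε, mul_comm] at hw
    rw [not_lt, le_div_iff₀ (by positivity)] at h
    push_cast at h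
    rw [Set.mem_ofPred_eq, div_div, div_le_iff₀ (by positivity), ← mul_assoc]
    set c := (n.factorial : ℝ) * p ^ H.edgeSet.ncard
    have hc : 0 < c := by positivity
    calc c ≤ c * (ε * w) := le_mul_of_one_le_right hc.le hwε
      _ = ε * c * w := by ring
      _ ≤ _ := by gcongr

theorem sum_indicator_gnpWeight_le_one {n : ℕ} {p : ℝ} (hp0 : 0 < p) (hp1 : p < 1)
    (s : Set (SimpleGraph (Fin n))) :
    ∑ G : SimpleGraph (Fin n), s.indicator (gnpWeight n p) G ≤ 1 := by
  rw [← sum_bernoulliWeight (E := finiteEdges (⊤ : SimpleGraph (Fin n))) (p := p),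
    ← sum_finiteEdges]
  refine Finset.sum_le_sum fun G _ => ?_
  rw [bernoulliWeight_finiteEdges]
  exact Set.indicator_le_self' (fun G' _ => gnpWeight_nonneg hp0 hp1 G') G

end Estimates

/-- Let `D` be a positive integer, `p ∈ (0,1)` a constant, and `ω : ℕ → ℝ` any function
tending to infinity.  For each `n` let `H n` be a simple graph on `n` vertices with maximum
degree at most `D`, with `e_n` edges and `aut (H n)` automorphisms.  Then the probability
that a random graph `G ∈ G(n,p)` satisfies
`C_{H n}(G) ≥ (n! · p^{e_n} / aut (H n)) / ω n` tends to `1` as `n → ∞`. -/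
theorem random_graph_count_lower_bound (D : ℕ) (hD : 0 < D) (p : ℝ) (hp0 : 0 < p)
    (hp1 : p < 1) (ω : ℕ → ℝ) (hω : Filter.Tendsto ω Filter.atTop Filter.atTop)
    (H : (n : ℕ) → SimpleGraph (Fin n))
    (hdeg : ∀ n : ℕ, ∀ v : Fin n, ({u : Fin n | (H n).Adj v u}).ncard ≤ D) :
    Filter.Tendsto
      (fun n : ℕ =>
        ∑ G : SimpleGraph (Fin n),
          Set.indicator
            {G' : SimpleGraph (Fin n) |
              (n.factorial : ℝ) * p ^ (H n).edgeSet.ncard / (numAut (H n)) / ω n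
                ≤ (numCopies (H n) G' : ℝ)}
            (gnpWeight n p) G)
      Filter.atTop (nhds 1) := by
  have hdeg' : ∀ n v, ((H n).neighborSet v).ncard ≤ D := hdeg
  rw [Metric.tendsto_nhds]
  intro η hη
  set K := Real.exp (2 * (D : ℝ) ^ 2 / p) with hK
  have hK0 : 0 < K := Real.exp_pos _
  set ε := η / (4 * K) with hε
  have hε0 : 0 < ε := by positivity
  have herr := (tendsto_secondMomentError hp0 hp1 D).div_const (ε ^ 2)
  rw [zero_div] at herr
  filter_upwards [herr.eventually_lt_const (half_pos hη), hω.eventually_ge_atTop ε⁻¹,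
    Filter.eventually_ge_atTop 3, Filter.eventually_ge_atTop (4 * D)] with n h1 h2 h3 h4
  have hlow := sum_indicator_gnpWeight_ge h3 h4 hp0 hp1 (hdeg' n) hε0 h2
  have hup := sum_indicator_gnpWeight_le_one hp0 hp1
    {G' : SimpleGraph (Fin n) |
      (n.factorial : ℝ) * p ^ (H n).edgeSet.ncard / (numAut (H n)) / ω n ≤ (numCopies (H n) G' : ℝ)}
  have hεK : 2 * ε * K = η / 2 := by
    rw [hε]
    field_simp
    norm_num
  rw [← hK, hεK] at hlow
  rw [Real.dist_eq, abs_sub_lt_iff]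
  constructor <;> linarith
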